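/- arXiv:2312.14222 — 2 statements merged into one kernel-verified Lean document; each statement's English description precedes it below -/
import Mathlib

section
/- Let p₁, p₂ > 0 be real numbers with p₁ + p₂ = 1, let μ₁, μ₂ ∈ ℝ, let σ₁, σ₂ > 0, and set σ̄ = p₁·σ₁ + p₂·σ₂. Then the Bayes error of the binary classification problem whose class priors are p₁, p₂ and whose class-conditional densities are the Gaussian densities φ_{μ₁,σ₁} and φ_{μ₂,σ₂} satisfies ∫_ℝ min(p₁·φ_{μ₁,σ₁}(x), p₂·φ_{μ₂,σ₂}(x)) dx ≤ 2·p₁·p₂ / (1 + p₁·p₂·(μ₁ − μ₂)²/σ̄). -/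
open MeasureTheory Real

/-- The one-dimensional Gaussian density with mean `m` and variance `σ`. -/
noncomputable def gaussianDensity1D (m σ : ℝ) (x : ℝ) : ℝ :=
  (2 * π * σ) ^ (-(1 : ℝ) / 2) * Real.exp (-(x - m) ^ 2 / (2 * σ))

open ProbabilityTheory in
lemma gaussianDensity1D_eq (m σ : ℝ) (hσ : 0 < σ) (x : ℝ) :
    gaussianDensity1D m σ x = gaussianPDFReal m ⟨σ, hσ.le⟩ x := by
  unfold gaussianDensity1D gaussianPDFReal
  have h : (2 * π * σ) ^ (-(1 : ℝ) / 2) = (√(2 * π * σ))⁻¹ := by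
    rw [Real.sqrt_eq_rpow, ← Real.rpow_neg (by positivity)]
    norm_num
  rw [h]
  rfl

open ProbabilityTheory in
lemma gaussian_sq_aux (m σ : ℝ) (hσ : 0 < σ) (A B : ℝ) :
    Integrable (fun x => gaussianDensity1D m σ x * (A + B * x) ^ 2) ∧
    ∫ x, gaussianDensity1D m σ x * (A + B * x) ^ 2 = (A + B * m) ^ 2 + B ^ 2 * σ := by
  set v : NNReal := ⟨σ, hσ.le⟩ with hv
  have hv0 : v ≠ 0 := by
    intro h
    have : (v : ℝ) = 0 := by rw [h]; rfl
    exact hσ.ne' this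
  have hfun : (fun x => gaussianDensity1D m σ x * (A + B * x) ^ 2)
      = fun x => gaussianPDFReal m v x • (A + B * x) ^ 2 := by
    funext x
    rw [gaussianDensity1D_eq m σ hσ x, smul_eq_mul]
  have h2 : MemLp (id : ℝ → ℝ) 2 (gaussianReal m v) := memLp_id_gaussianReal' 2 (by simp)
  have i1 : Integrable (fun x : ℝ => x) (gaussianReal m v) := h2.integrable (by norm_num)
  have i2 : Integrable (fun x : ℝ => x ^ 2) (gaussianReal m v) := h2.integrable_sq
  have e2 : ∫ x, x ^ 2 ∂(gaussianReal m v) = σ + m ^ 2 := by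
    have hvar := variance_eq_sub h2
    rw [variance_id_gaussianReal] at hvar
    simp only [id, Pi.pow_apply, integral_id_gaussianReal] at hvar
    have : (v : ℝ) = σ := rfl
    linarith
  have hexp : (fun x : ℝ => (A + B * x) ^ 2) = fun x => (A ^ 2 + (2 * A * B) * x) + B ^ 2 * x ^ 2 := by
    funext x; ring
  have ia : Integrable (fun x : ℝ => A ^ 2 + (2 * A * B) * x) (gaussianReal m v) :=
    (integrable_const _).add (i1.const_mul _)
  have iq : Integrable (fun x : ℝ => (A + B * x) ^ 2) (gaussianReal m v) := by
    rw [hexp]; exact ia.add (i2.const_mul _)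
  constructor
  · rw [hfun]
    rw [gaussianReal_of_var_ne_zero m hv0, integrable_withDensity_iff_integrable_smul'
      (measurable_gaussianPDF m v) (by simp [gaussianPDF_lt_top])] at iq
    simpa only [toReal_gaussianPDF] using iq
  · rw [hfun, ← integral_gaussianReal_eq_integral_smul hv0, hexp,
      integral_add ia (i2.const_mul _), integral_add (integrable_const _) (i1.const_mul _),
      integral_const_mul, integral_const_mul, e2, integral_id_gaussianReal]
    simp
    ring

lemma min_aux (a b t : ℝ) (ha : 0 ≤ a) (hb : 0 ≤ b) :
    min a b ≤ 2 * (a * (1 - t) ^ 2 + b * t ^ 2) := by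
  have h1 := mul_le_mul_of_nonneg_right (min_le_left a b) (sq_nonneg (1 - t))
  have h2 := mul_le_mul_of_nonneg_right (min_le_right a b) (sq_nonneg t)
  have h3 := mul_nonneg (le_min ha hb) (sq_nonneg (1 - 2 * t))
  nlinarith

/-- Lemma 5.3 in the one-dimensional setting: the Bayes error of the binary
classification problem with priors `p₁, p₂` and Gaussian class-conditional
densities `φ_{μ₁,σ₁}, φ_{μ₂,σ₂}` is at most
`2·p₁·p₂ / (1 + p₁·p₂·(μ₁ - μ₂)²/σ̄)`, where `σ̄ = p₁·σ₁ + p₂·σ₂`. -/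
theorem bayes_error_gaussian_upper_bound
    (p₁ p₂ : ℝ) (hp₁ : 0 < p₁) (hp₂ : 0 < p₂) (hp : p₁ + p₂ = 1)
    (μ₁ μ₂ : ℝ) (σ₁ σ₂ : ℝ) (hσ₁ : 0 < σ₁) (hσ₂ : 0 < σ₂) :
    ∫ x, min (p₁ * gaussianDensity1D μ₁ σ₁ x) (p₂ * gaussianDensity1D μ₂ σ₂ x) ≤
      2 * p₁ * p₂ / (1 + p₁ * p₂ * ((μ₁ - μ₂) ^ 2 / (p₁ * σ₁ + p₂ * σ₂))) := by

  have hS : 0 < p₁ * σ₁ + p₂ * σ₂ := by positivity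
  set S := p₁ * σ₁ + p₂ * σ₂ with hSdef
  have hD : 0 < S + p₁ * p₂ * (μ₁ - μ₂) ^ 2 := by positivity
  set D := S + p₁ * p₂ * (μ₁ - μ₂) ^ 2 with hDdef
  obtain ⟨c, hc⟩ : ∃ c, c = p₁ * p₂ * (μ₁ - μ₂) / D := ⟨_, rfl⟩
  obtain ⟨A, hA⟩ : ∃ A, A = p₁ - c * (p₁ * μ₁ + p₂ * μ₂) := ⟨_, rfl⟩
  obtain ⟨I1, E1⟩ := gaussian_sq_aux μ₁ σ₁ hσ₁ (1 - A) (-c)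
  obtain ⟨I2, E2⟩ := gaussian_sq_aux μ₂ σ₂ hσ₂ A c
  have hn : ∀ m σ x : ℝ, 0 < σ → 0 ≤ gaussianDensity1D m σ x := by
    intro m σ x h
    unfold gaussianDensity1D
    positivity
  have key : ∫ x, min (p₁ * gaussianDensity1D μ₁ σ₁ x) (p₂ * gaussianDensity1D μ₂ σ₂ x) ≤
      ∫ x, ((2 * p₁) * (gaussianDensity1D μ₁ σ₁ x * ((1 - A) + (-c) * x) ^ 2)
        + (2 * p₂) * (gaussianDensity1D μ₂ σ₂ x * (A + c * x) ^ 2)) := by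
    apply integral_mono_of_nonneg
    · exact Filter.Eventually.of_forall fun x =>
        le_min (mul_nonneg hp₁.le (hn _ _ _ hσ₁)) (mul_nonneg hp₂.le (hn _ _ _ hσ₂))
    · exact (I1.const_mul _).add (I2.const_mul _)
    · refine Filter.Eventually.of_forall fun x => ?_
      refine (min_aux _ _ (A + c * x) (mul_nonneg hp₁.le (hn _ _ _ hσ₁))
        (mul_nonneg hp₂.le (hn _ _ _ hσ₂))).trans (le_of_eq ?_)
      ring
  rw [integral_add (I1.const_mul _) (I2.const_mul _), integral_const_mul, integral_const_mul,
    E1, E2] at key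
  refine key.trans (le_of_eq ?_)
  have hR : 2 * p₁ * p₂ / (1 + p₁ * p₂ * ((μ₁ - μ₂) ^ 2 / S)) = 2 * p₁ * p₂ * S / D := by
    have : 1 + p₁ * p₂ * ((μ₁ - μ₂) ^ 2 / S) = D / S := by
      rw [hDdef]; field_simp
    rw [this]; field_simp
  have hcD : c * D = p₁ * p₂ * (μ₁ - μ₂) := by rw [hc]; field_simp
  have hp2 : p₂ = 1 - p₁ := by linarith
  have hL : 2 * p₁ * ((1 - A + -c * μ₁) ^ 2 + (-c) ^ 2 * σ₁) + 2 * p₂ * ((A + c * μ₂) ^ 2 + c ^ 2 * σ₂)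
      = 2 * (p₁ * p₂ - 2 * c * (p₁ * p₂ * (μ₁ - μ₂)) + c * (c * D)) := by
    rw [hA, hDdef, hSdef, hp2]; ring
  rw [hR, hL, eq_div_iff hD.ne', hcD]
  have : S = D - p₁ * p₂ * (μ₁ - μ₂) ^ 2 := by rw [hDdef]; ring
  rw [this]
  linear_combination (-2) * (p₁ * p₂ * (μ₁ - μ₂)) * hcD
end

section
/- Let d ≥ 1, let p₁, p₂ > 0 be real numbers with p₁ + p₂ = 1, let μ₁, μ₂ ∈ ℝ^d, let Σ₁, Σ₂ be positive definite real d×d matrices, and set Σ̄ = p₁·Σ₁ + p₂·Σ₂ (which is positive definite, hence invertible). Let f_{μ,Σ}(x) = (2π)^{−d/2}·(det Σ)^{−1/2}·exp(−½·(x − μ)ᵀ Σ⁻¹ (x − μ)) denote the multivariate Gaussian density. Then ∫_{ℝ^d} min(p₁·f_{μ₁,Σ₁}(x), p₂·f_{μ₂,Σ₂}(x)) dx ≤ 2·p₁·p₂ / (1 + p₁·p₂·(μ₁ − μ₂)ᵀ Σ̄⁻¹ (μ₁ − μ₂)). -/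
open MeasureTheory Real Matrix

/-- The multivariate Gaussian density on `ℝ^d` with mean `m` and covariance
matrix `Σ` (given via its inverse in the quadratic form). -/
noncomputable def multivariateGaussianDensity {d : ℕ} (m : Fin d → ℝ)
    (S : Matrix (Fin d) (Fin d) ℝ) (x : Fin d → ℝ) : ℝ :=
  (2 * π) ^ (-(d : ℝ) / 2) * (S.det) ^ (-(1 : ℝ) / 2) *
    Real.exp (-(1 / 2) * ((x - m) ⬝ᵥ (S⁻¹ *ᵥ (x - m))))

open ProbabilityTheory in
lemma pi_gauss (d : ℕ) : Measure.pi (fun _ : Fin d ↦ gaussianReal 0 1) =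
    (volume : Measure (Fin d → ℝ)).withDensity
      (fun z => ENNReal.ofReal (∏ i, gaussianPDFReal 0 1 (z i))) := by
  refine Measure.pi_eq fun s hs => ?_
  rw [withDensity_apply _ (MeasurableSet.univ_pi hs), volume_pi, Measure.restrict_pi_pi,
    ← ofReal_integral_eq_lintegral_ofReal]
  · rw [integral_fintype_prod_eq_prod (f := fun _ => gaussianPDFReal 0 1),
      ENNReal.ofReal_prod_of_nonneg]
    · simp_rw [gaussianReal_apply_eq_integral 0 one_ne_zero]
    · intro i _
      exact integral_nonneg fun x => gaussianPDFReal_nonneg _ _ _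
  · exact Integrable.fintype_prod (f := fun _ => gaussianPDFReal 0 1)
      fun i => (integrable_gaussianPDFReal 0 1).restrict
  · exact Filter.Eventually.of_forall fun z => Finset.prod_nonneg fun i _ => gaussianPDFReal_nonneg _ _ _

open ProbabilityTheory in
lemma prod_pdf (d : ℕ) (z : Fin d → ℝ) : ∏ i, gaussianPDFReal 0 1 (z i) =
    (2 * π) ^ (-(d : ℝ) / 2) * Real.exp (-(1 / 2) * (z ⬝ᵥ z)) := by
  simp only [gaussianPDFReal, NNReal.coe_one, mul_one, sub_zero, Finset.prod_mul_distrib,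
    Finset.prod_const, Finset.card_univ, Fintype.card_fin, ← Real.exp_sum]
  congr 1
  · rw [Real.sqrt_eq_rpow, ← Real.rpow_neg (by positivity), ← Real.rpow_natCast,
      ← Real.rpow_mul (by positivity)]
    congr 1; ring
  · congr 1
    simp only [dotProduct, Finset.mul_sum]
    refine Finset.sum_congr rfl fun i _ => by ring

open ProbabilityTheory in
lemma std_moment (d : ℕ) (a : ℝ) (u : Fin d → ℝ) :
    Integrable (fun z : Fin d → ℝ => (a + u ⬝ᵥ z) ^ 2 *
      ((2 * π) ^ (-(d : ℝ) / 2) * Real.exp (-(1 / 2) * (z ⬝ᵥ z)))) ∧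
    ∫ z : Fin d → ℝ, (a + u ⬝ᵥ z) ^ 2 *
      ((2 * π) ^ (-(d : ℝ) / 2) * Real.exp (-(1 / 2) * (z ⬝ᵥ z))) = a ^ 2 + u ⬝ᵥ u := by
  set P := Measure.pi (fun _ : Fin d ↦ gaussianReal 0 1) with hP
  have hpos : ∀ z : Fin d → ℝ, 0 ≤ ∏ i, gaussianPDFReal 0 1 (z i) :=
    fun z => Finset.prod_nonneg fun i _ => gaussianPDFReal_nonneg _ _ _
  have hmeas : Measurable (fun z : Fin d → ℝ => ENNReal.ofReal (∏ i, gaussianPDFReal 0 1 (z i))) := by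
    have := measurable_gaussianPDFReal 0 1
    fun_prop
  have hi : ∀ i, MemLp (fun z : Fin d → ℝ => u i * z i) 2 P := fun i =>
    MemLp.const_mul ((IsGaussian.memLp_two_id (μ := gaussianReal 0 1)).comp_measurePreserving
      (measurePreserving_eval _ i)) (u i)
  have hX : MemLp (∑ i, fun z : Fin d → ℝ => u i * z i) 2 P := memLp_finsetSum' _ fun i _ => hi i
  have hXe : (∑ i, fun z : Fin d → ℝ => u i * z i) = fun z => u ⬝ᵥ z := by
    ext z; simp [dotProduct]
  have hvar : Var[∑ i, fun z : Fin d → ℝ => u i * z i; P] = u ⬝ᵥ u := by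
    rw [hP, variance_sum_pi (X := fun i x => u i * x)]
    · change ∑ i, Var[fun x ↦ _ * (id x); gaussianReal 0 1] = _
      simp_rw [variance_const_mul, variance_id_gaussianReal]
      simp [dotProduct, sq]
    · exact fun i ↦ IsGaussian.memLp_two_id.const_mul _
  have hmean : ∫ z, u ⬝ᵥ z ∂P = 0 := by
    simp only [dotProduct]
    rw [integral_finsetSum _ fun i _ => (hi i).integrable one_le_two]
    simp [integral_const_mul, hP, integral_eval]
  rw [hXe] at hX hvar
  have hY : MemLp (fun z => a + u ⬝ᵥ z) 2 P := (memLp_const a).add hX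
  have hint := hY.integrable_sq
  have hval : ∫ z, (a + u ⬝ᵥ z) ^ 2 ∂P = a ^ 2 + u ⬝ᵥ u := by
    have h1 := variance_eq_sub hY
    rw [variance_const_add hX.aestronglyMeasurable, hvar,
      integral_add (integrable_const a) (hX.integrable one_le_two), hmean] at h1
    simp only [Pi.pow_apply, integral_const, probReal_univ, one_smul, add_zero] at h1
    linarith
  simp_rw [← prod_pdf]
  rw [hP, pi_gauss] at hint hval
  rw [integral_withDensity_eq_integral_toReal_smul hmeas (by simp)] at hval
  rw [integrable_withDensity_iff hmeas (by simp)] at hint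
  simp only [ENNReal.toReal_ofReal (hpos _), smul_eq_mul] at hval hint
  refine ⟨hint, ?_⟩
  rw [← hval]
  simp only [mul_comm]

open scoped MatrixOrder in
lemma exists_factor {d : ℕ} {S : Matrix (Fin d) (Fin d) ℝ} (hS : S.PosDef) :
    ∃ B : Matrix (Fin d) (Fin d) ℝ, S = B * Bᵀ := by
  obtain ⟨C, hC⟩ := CStarAlgebra.nonneg_iff_eq_star_mul_self.mp hS.posSemidef.nonneg
  exact ⟨Cᵀ, by simpa [star_eq_conjTranspose] using hC⟩

lemma gauss_moment {d : ℕ} (a : ℝ) (w m : Fin d → ℝ) {S : Matrix (Fin d) (Fin d) ℝ}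
    (hS : S.PosDef) :
    Integrable (fun x => (a + w ⬝ᵥ (x - m)) ^ 2 * multivariateGaussianDensity m S x) ∧
    ∫ x, (a + w ⬝ᵥ (x - m)) ^ 2 * multivariateGaussianDensity m S x = a ^ 2 + w ⬝ᵥ (S *ᵥ w) := by
  obtain ⟨B, hB⟩ := exists_factor hS
  have hdet : S.det = B.det ^ 2 := by rw [hB, det_mul, det_transpose, sq]
  have hB0 : B.det ≠ 0 := by
    intro h; have := hS.det_pos; rw [hdet, h] at this; simp at this
  have hBu : IsUnit B.det := isUnit_iff_ne_zero.mpr hB0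
  set g : (Fin d → ℝ) → ℝ := fun y => (a + w ⬝ᵥ y) ^ 2 * multivariateGaussianDensity 0 S y with hg
  have hgx : (fun x => (a + w ⬝ᵥ (x - m)) ^ 2 * multivariateGaussianDensity m S x) =
      fun x => g (x - m) := by
    ext x; simp [hg, multivariateGaussianDensity]
  have hgB : ∀ z, g (B *ᵥ z) = |B.det|⁻¹ * ((a + (Bᵀ *ᵥ w) ⬝ᵥ z) ^ 2 *
      ((2 * π) ^ (-(d : ℝ) / 2) * Real.exp (-(1 / 2) * (z ⬝ᵥ z)))) := by
    intro z
    have h1 : w ⬝ᵥ (B *ᵥ z) = (Bᵀ *ᵥ w) ⬝ᵥ z := by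
      rw [dotProduct_mulVec, mulVec_transpose]
    have h2 : (B *ᵥ z) ⬝ᵥ (S⁻¹ *ᵥ (B *ᵥ z)) = z ⬝ᵥ z := by
      rw [hB, Matrix.mul_inv_rev, mulVec_mulVec, Matrix.mul_assoc, Matrix.nonsing_inv_mul _ hBu,
        Matrix.mul_one, dotProduct_mulVec, ← mulVec_transpose, mulVec_mulVec,
        transpose_nonsing_inv, transpose_transpose, Matrix.nonsing_inv_mul _ hBu, one_mulVec]
    have h3 : (S.det) ^ (-(1 : ℝ) / 2) = |B.det|⁻¹ := by
      rw [hdet, neg_div, Real.rpow_neg (by positivity), ← Real.sqrt_eq_rpow, Real.sqrt_sq_eq_abs]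
    simp only [hg, multivariateGaussianDensity, sub_zero, h1, h2, h3]
    ring
  have hmap := Real.map_matrix_volume_pi_eq_smul_volume_pi hB0
  have hdp : (0:ℝ) < |B.det| := abs_pos.mpr hB0
  have hemb : MeasurableEmbedding (toLin' B) := by
    have hc : Continuous (toLin' B) := LinearMap.continuous_on_pi _
    refine hc.measurableEmbedding ?_
    intro x y hxy
    simp only [toLin'_apply] at hxy
    exact Matrix.mulVec_injective_of_isUnit ((Matrix.isUnit_iff_isUnit_det _).2 hBu) hxy
  have hstd := std_moment d a (Bᵀ *ᵥ w)
  have hcomp : (fun z => g (toLin' B z)) = fun z => |B.det|⁻¹ * ((a + (Bᵀ *ᵥ w) ⬝ᵥ z) ^ 2 *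
      ((2 * π) ^ (-(d : ℝ) / 2) * Real.exp (-(1 / 2) * (z ⬝ᵥ z)))) := by
    ext z; rw [toLin'_apply, hgB]
  have hI : Integrable (g ∘ toLin' B) := by
    have : g ∘ toLin' B = fun z => g (toLin' B z) := rfl
    rw [this, hcomp]
    exact hstd.1.const_mul _
  have hI2 := hemb.integrable_map_iff.mpr hI
  have hE := hemb.integral_map (μ := volume) g
  rw [hcomp, integral_const_mul, hstd.2, hmap, integral_smul_measure,
    ENNReal.toReal_ofReal (abs_nonneg _), abs_inv, smul_eq_mul] at hE
  have hE' := mul_left_cancel₀ (inv_ne_zero hdp.ne') hE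
  rw [hmap, integrable_smul_measure (by simpa using hB0) (by simp)] at hI2
  rw [hgx]
  refine ⟨hI2.comp_sub_right m, ?_⟩
  rw [integral_sub_right_eq_self g m, hE', hB, ← mulVec_mulVec, dotProduct_mulVec w B,
    ← mulVec_transpose]

lemma min_le_quad (a b t : ℝ) (ha : 0 < a) (hb : 0 < b) :
    min a b ≤ 2 * (t ^ 2 * a + (1 - t) ^ 2 * b) := by
  rcases le_total a b with h | h
  · rw [min_eq_left h]
    nlinarith [sq_nonneg (2 * t - 1), mul_nonneg (sub_nonneg.2 h) (sq_nonneg (1 - t))]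
  · rw [min_eq_right h]
    nlinarith [sq_nonneg (2 * t - 1), mul_nonneg (sub_nonneg.2 h) (sq_nonneg t)]

lemma dens_pos {d : ℕ} (m : Fin d → ℝ) {S : Matrix (Fin d) (Fin d) ℝ} (hS : S.PosDef)
    (x : Fin d → ℝ) : 0 < multivariateGaussianDensity m S x := by
  have := hS.det_pos
  unfold multivariateGaussianDensity
  positivity

/-- Lemma 5.3: the divergence estimation of the Bayes error upper bound for two
multivariate Gaussian class-conditional distributions with priors `p₁, p₂`,
means `μ₁, μ₂`, positive-definite covariances `S₁, S₂`, and average covariance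
`Σ̄ = p₁·S₁ + p₂·S₂`. -/
theorem bayes_error_multivariate_gaussian_upper_bound
    (d : ℕ) (hd : 1 ≤ d)
    (p₁ p₂ : ℝ) (hp₁ : 0 < p₁) (hp₂ : 0 < p₂) (hp : p₁ + p₂ = 1)
    (μ₁ μ₂ : Fin d → ℝ) (S₁ S₂ : Matrix (Fin d) (Fin d) ℝ)
    (hS₁ : S₁.PosDef) (hS₂ : S₂.PosDef) :
    ∫ x : Fin d → ℝ,
        min (p₁ * multivariateGaussianDensity μ₁ S₁ x)
            (p₂ * multivariateGaussianDensity μ₂ S₂ x) ≤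
      2 * p₁ * p₂ /
        (1 + p₁ * p₂ *
          ((μ₁ - μ₂) ⬝ᵥ ((p₁ • S₁ + p₂ • S₂)⁻¹ *ᵥ (μ₁ - μ₂)))) := by
  have hS : (p₁ • S₁ + p₂ • S₂).PosDef := (hS₁.smul hp₁).add (hS₂.smul hp₂)
  set S := p₁ • S₁ + p₂ • S₂ with hSdef
  set D := (μ₁ - μ₂) ⬝ᵥ (S⁻¹ *ᵥ (μ₁ - μ₂)) with hD
  have hD0 : 0 ≤ D := by
    have := hS.inv.posSemidef.dotProduct_mulVec_nonneg (μ₁ - μ₂)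
    rwa [star_trivial] at this
  set N := 1 + p₁ * p₂ * D with hN
  have hNpos : 0 < N := by positivity
  set k := -(p₁ * p₂) / N with hk
  set v := S⁻¹ *ᵥ (μ₁ - μ₂) with hv
  have hSv : S *ᵥ v = μ₁ - μ₂ := by
    rw [hv, mulVec_mulVec, Matrix.mul_nonsing_inv _ (isUnit_iff_ne_zero.mpr hS.det_pos.ne'),
      one_mulVec]
  have hvS : p₁ * (v ⬝ᵥ (S₁ *ᵥ v)) + p₂ * (v ⬝ᵥ (S₂ *ᵥ v)) = D := by
    have : v ⬝ᵥ (S *ᵥ v) = D := by rw [hSv, dotProduct_comm]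
    rw [← this, hSdef, add_mulVec, dotProduct_add, smul_mulVec, smul_mulVec, dotProduct_smul,
      dotProduct_smul, smul_eq_mul, smul_eq_mul]
  obtain ⟨i1, e1⟩ := gauss_moment (p₂ / N) (k • v) μ₁ hS₁
  obtain ⟨i2, e2⟩ := gauss_moment (p₁ / N) ((-k) • v) μ₂ hS₂
  have hrel : ∀ x, p₁ / N + ((-k) • v) ⬝ᵥ (x - μ₂) = 1 - (p₂ / N + (k • v) ⬝ᵥ (x - μ₁)) := by
    intro x
    have hvD : v ⬝ᵥ μ₁ - v ⬝ᵥ μ₂ = D := by rw [← dotProduct_sub, dotProduct_comm]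
    simp only [smul_dotProduct, dotProduct_sub, smul_eq_mul]
    have h1 : (p₁ + p₂) / N - k * D = 1 := by
      rw [hp, hk]; field_simp; rw [hN]; ring
    rw [← hvD] at h1
    rw [add_div] at h1
    linarith
  have hval : ∫ x, 2 * (p₁ * ((p₂ / N + (k • v) ⬝ᵥ (x - μ₁)) ^ 2 *
        multivariateGaussianDensity μ₁ S₁ x) +
      p₂ * ((p₁ / N + ((-k) • v) ⬝ᵥ (x - μ₂)) ^ 2 * multivariateGaussianDensity μ₂ S₂ x)) =
      2 * p₁ * p₂ / N := by
    rw [integral_const_mul, integral_add (i1.const_mul _) (i2.const_mul _), integral_const_mul,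
      integral_const_mul, e1, e2]
    simp only [smul_dotProduct, mulVec_smul, dotProduct_smul, smul_eq_mul]
    have : 2 * (p₁ * ((p₂ / N) ^ 2 + k * (k * (v ⬝ᵥ (S₁ *ᵥ v)))) +
        p₂ * ((p₁ / N) ^ 2 + -k * (-k * (v ⬝ᵥ (S₂ *ᵥ v))))) =
        2 * ((p₁ * p₂ * (p₁ + p₂)) / N ^ 2 + k ^ 2 *
          (p₁ * (v ⬝ᵥ (S₁ *ᵥ v)) + p₂ * (v ⬝ᵥ (S₂ *ᵥ v)))) := by ring
    rw [this, hvS, hp, hk]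
    field_simp
    rw [hN]
  rw [← hval]
  refine integral_mono_of_nonneg (Filter.Eventually.of_forall fun x => ?_)
    (((i1.const_mul _).add (i2.const_mul _)).const_mul _) (Filter.Eventually.of_forall fun x => ?_)
  · exact le_min (mul_pos hp₁ (dens_pos _ hS₁ _)).le (mul_pos hp₂ (dens_pos _ hS₂ _)).le
  · have := min_le_quad _ _ (p₂ / N + (k • v) ⬝ᵥ (x - μ₁)) (mul_pos hp₁ (dens_pos μ₁ hS₁ x))
      (mul_pos hp₂ (dens_pos μ₂ hS₂ x))
    refine this.trans (le_of_eq ?_)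
    simp only [hrel]
    ring
end
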